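/- arXiv:2206.15424 — 2 statements merged into one kernel-verified Lean document; each statement's English description precedes it below -/
import Mathlib

section
/- Let G be a connected graph in which no three distinct vertices are pairwise true twins, X a cluster modulator of G, 𝒞 an equivalence class of identical cliques of G − X with |𝒞| ≥ 2^{|X|+2} + |X| + 2, and C ∈ 𝒞. Let k be an integer with k ≥ max(1, t(𝒞)). If G has a resolving set of size at most k, then the graph G − V(C) obtained by deleting all vertices of C has a resolving set of size at most k − max(1, t(𝒞)). -/
open SimpleGraph

variable {V : Type*}

/-- Two distinct vertices are true twins if they have equal closed neighborhoods. -/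
def TrueTwins (G : SimpleGraph V) (u v : V) : Prop :=
  u ≠ v ∧ insert u (G.neighborSet u) = insert v (G.neighborSet v)

/-- Two distinct vertices are false twins if they have equal open neighborhoods. -/
def FalseTwins (G : SimpleGraph V) (u v : V) : Prop :=
  u ≠ v ∧ G.neighborSet u = G.neighborSet v

/-- A set `S` is a resolving set of `G`. -/
def IsResolving {W : Type*} (G : SimpleGraph W) (S : Set W) : Prop :=
  ∀ u v : W, u ≠ v → ∃ w ∈ S, G.dist w u ≠ G.dist w v

/-- A graph is a cluster graph: every connected component is a clique. -/
def IsClusterGraph {W : Type*} (H : SimpleGraph W) : Prop :=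
  ∀ a b : W, H.Reachable a b → a = b ∨ H.Adj a b

/-- `X` is a cluster modulator of `G`: `G - X` is a cluster graph. -/
def IsClusterModulator (G : SimpleGraph V) (X : Set V) : Prop :=
  IsClusterGraph (G.induce Xᶜ)

/-- `C` is a clique of `G - X`, i.e. a connected component of `G - X`
(which is a clique when `X` is a cluster modulator). -/
def IsCliqueComponent (G : SimpleGraph V) (X C : Set V) : Prop :=
  C.Nonempty ∧ C ⊆ Xᶜ ∧ (∀ a ∈ C, ∀ b ∈ C, a ≠ b → G.Adj a b) ∧
    (∀ a ∈ C, ∀ b : V, b ∉ X → G.Adj a b → b ∈ C)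

/-- Two vertices are clones (w.r.t. the modulator `X`) if they have the same
neighborhood in `X`. -/
def Clones (G : SimpleGraph V) (X : Set V) (u v : V) : Prop :=
  G.neighborSet u ∩ X = G.neighborSet v ∩ X

/-- Two cliques of `G - X` are identical if their signatures (multisets of
neighborhoods in `X`) coincide, i.e. there is a bijection matching vertices
with equal neighborhoods in `X`. -/
def Identical (G : SimpleGraph V) (X C1 C2 : Set V) : Prop :=
  ∃ f : ↥C1 ≃ ↥C2, ∀ u : ↥C1, G.neighborSet (↑(f u)) ∩ X = G.neighborSet (↑u) ∩ X

/-- `𝒞` is an equivalence class of identical cliques of `G - X`: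
a maximal set of pairwise identical cliques of `G - X`. -/
def IsIdenticalClass (G : SimpleGraph V) (X : Set V) (𝒞 : Set (Set V)) : Prop :=
  (∀ C ∈ 𝒞, IsCliqueComponent G X C) ∧
  (∀ C1 ∈ 𝒞, ∀ C2 ∈ 𝒞, Identical G X C1 C2) ∧
  (∀ C, IsCliqueComponent G X C → (∃ C' ∈ 𝒞, Identical G X C C') → C ∈ 𝒞)

/-- The number of unordered pairs of true twins of `G` contained in `C`. -/
noncomputable def twinPairCount (G : SimpleGraph V) (C : Set V) : ℕ :=
  {p : Set V | ∃ u ∈ C, ∃ v ∈ C, TrueTwins G u v ∧ p = {u, v}}.ncard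

/-- No three distinct vertices of `G` are pairwise true twins. -/
def NoThreeTrueTwins (G : SimpleGraph V) : Prop :=
  ¬ ∃ u v w : V, TrueTwins G u v ∧ TrueTwins G u w ∧ TrueTwins G v w

/-- No three distinct vertices of `G` are pairwise false twins. -/
def NoThreeFalseTwins (G : SimpleGraph V) : Prop :=
  ¬ ∃ u v w : V, FalseTwins G u v ∧ FalseTwins G u w ∧ FalseTwins G v w

/-- `I` is an independent set of `G - X` corresponding to a connected component
of the complement of `G - X`. -/
def IsCoComponent (G : SimpleGraph V) (X I : Set V) : Prop :=
  I.Nonempty ∧ I ⊆ Xᶜ ∧ (∀ a ∈ I, ∀ b ∈ I, a ≠ b → ¬ G.Adj a b) ∧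
    (∀ a ∈ I, ∀ b : V, b ∉ X → a ≠ b → ¬ G.Adj a b → b ∈ I)

section CliqueDeletion

variable {G : SimpleGraph V} {X : Set V}

/-- A graph homomorphism into a possibly different graph does not increase distances. -/
lemma SimpleGraph.Connected.dist_map_le {W : Type*} {H : SimpleGraph W} (hG : G.Connected)
    (φ : G →g H) (a b : V) : H.dist (φ a) (φ b) ≤ G.dist a b := by
  obtain ⟨p, hp⟩ := hG.exists_walk_length_eq_dist a b
  rw [← hp, ← Walk.length_map φ p]
  exact dist_le _

lemma SimpleGraph.Connected.dist_iso (hG : G.Connected) (σ : G ≃g G) (a b : V) :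
    G.dist (σ a) (σ b) = G.dist a b := by
  apply le_antisymm (hG.dist_map_le σ.toHom a b)
  simpa using hG.dist_map_le σ.symm.toHom (σ a) (σ b)

/-- An adjacency-preserving involution of the vertices is an automorphism. -/
def SimpleGraph.isoOfInvolutive (g : V → V) (hg : Function.Involutive g)
    (hadj : ∀ a b, G.Adj a b → G.Adj (g a) (g b)) : G ≃g G where
  toEquiv := hg.toPerm g
  map_rel_iff' {a b} := by
    refine ⟨fun h => ?_, hadj a b⟩
    have := hadj _ _ h
    simpa [hg a, hg b] using this

lemma TrueTwins.adj_iff {u v x : V} (h : TrueTwins G u v) (hu : x ≠ u) (hv : x ≠ v) :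
    G.Adj u x ↔ G.Adj v x := by
  have := Set.ext_iff.1 h.2 x
  simpa [hu, hv] using this

lemma TrueTwins.dist_eq {u v w : V} (hG : G.Connected) (h : TrueTwins G u v)
    (hu : w ≠ u) (hv : w ≠ v) : G.dist w u = G.dist w v := by
  classical
  let σ : G ≃g G := isoOfInvolutive (Equiv.swap u v) (Equiv.swap_apply_self u v) (by
    intro a b hab
    have key : ∀ x, x ≠ u → x ≠ v → (G.Adj u x ↔ G.Adj v x) := fun x => h.adj_iff
    have := hab.ne
    rw [Equiv.swap_apply_def, Equiv.swap_apply_def]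
    split_ifs <;> subst_vars <;> grind [SimpleGraph.Adj.symm])
  have hw : σ w = w := Equiv.swap_apply_of_ne_of_ne hu hv
  have huv : σ u = v := Equiv.swap_apply_left u v
  rw [← hG.dist_iso σ w u, hw, huv]

lemma IsCliqueComponent.eq_of_mem {C D : Set V} (hC : IsCliqueComponent G X C)
    (hD : IsCliqueComponent G X D) {v : V} (hvC : v ∈ C) (hvD : v ∈ D) : C = D := by
  have aux : ∀ {C D : Set V}, IsCliqueComponent G X C → IsCliqueComponent G X D →
      v ∈ C → v ∈ D → C ⊆ D := by
    intro C D hC hD hvC hvD a ha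
    by_cases hav : v = a
    · exact hav ▸ hvD
    · exact hD.2.2.2 v hvD a (hC.2.1 ha) (hC.2.2.1 v hvC a ha hav)
  exact (aux hC hD hvC hvD).antisymm (aux hD hC hvD hvC)

/-- Two different identical cliques can be exchanged by an automorphism. -/
lemma exists_iso_of_equiv {C D : Set V} (hC : IsCliqueComponent G X C)
    (hD : IsCliqueComponent G X D) (hne : C ≠ D) (f : C ≃ D)
    (hf : ∀ u : C, G.neighborSet (f u) ∩ X = G.neighborSet u ∩ X) :
    ∃ σ : G ≃g G, (∀ u : C, σ u = f u) ∧ (∀ u : D, σ u = f.symm u) ∧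
      ∀ u, u ∉ C → u ∉ D → σ u = u := by
  classical
  have hdis : ∀ v, v ∈ C → v ∉ D := fun v h h' => hne (hC.eq_of_mem hD h h')
  let g : V → V := fun v =>
    if h : v ∈ C then f ⟨v, h⟩ else if h : v ∈ D then f.symm ⟨v, h⟩ else v
  have g1 : ∀ u : C, g u = f u := fun u => by simp [g]
  have g2 : ∀ u : D, g u = f.symm u := fun u => by
    have : (u : V) ∉ C := fun h => hdis _ h u.2
    simp [g, this]
  have g3 : ∀ u, u ∉ C → u ∉ D → g u = u := fun u h h' => by simp [g, h, h']
  have hinv : Function.Involutive g := by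
    intro v
    by_cases h : v ∈ C
    · rw [g1 ⟨v, h⟩, g2]; simp
    by_cases h' : v ∈ D
    · rw [g2 ⟨v, h'⟩, g1]; simp
    rw [g3 v h h', g3 v h h']
  have gX : ∀ x ∈ X, g x = x := fun x hx =>
    g3 x (fun h => hC.2.1 h hx) (fun h => hD.2.1 h hx)
  have gadj : ∀ v, ∀ x ∈ X, G.Adj (g v) x ↔ G.Adj v x := by
    have hf' : ∀ u : C, ∀ x ∈ X, G.Adj (f u) x ↔ G.Adj u x := by
      intro u x hx
      have := Set.ext_iff.1 (hf u) x
      simpa [hx] using this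
    intro v x hx
    by_cases h : v ∈ C
    · rw [g1 ⟨v, h⟩]; exact hf' _ x hx
    by_cases h' : v ∈ D
    · rw [g2 ⟨v, h'⟩, ← hf' _ x hx]; simp
    rw [g3 v h h']
  refine ⟨isoOfInvolutive g hinv ?_, g1, g2, g3⟩
  intro a b hab
  by_cases hb : b ∈ X
  · rw [gX b hb]; exact (gadj a b hb).2 hab
  by_cases ha : a ∈ X
  · rw [gX a ha]; exact ((gadj b a ha).2 hab.symm).symm
  by_cases h : a ∈ C
  · have h' := hC.2.2.2 a h b hb hab
    rw [g1 ⟨a, h⟩, g1 ⟨b, h'⟩]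
    refine hD.2.2.1 _ (f _).2 _ (f _).2 fun e => hab.ne ?_
    simpa using f.injective (Subtype.ext e)
  by_cases h1 : a ∈ D
  · have h' := hD.2.2.2 a h1 b hb hab
    rw [g2 ⟨a, h1⟩, g2 ⟨b, h'⟩]
    refine hC.2.2.1 _ (f.symm _).2 _ (f.symm _).2 fun e => hab.ne ?_
    simpa using f.symm.injective (Subtype.ext e)
  have h2 : b ∉ C := fun h' => h (hC.2.2.2 b h' a ha hab.symm)
  have h3 : b ∉ D := fun h' => h1 (hD.2.2.2 b h' a ha hab.symm)
  rw [g3 a h h1, g3 b h2 h3]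
  exact hab

/-- Clones in two different identical cliques have equal distances to the vertices outside these
cliques. -/
lemma dist_eq_of_clones {C D : Set V} (hG : G.Connected) (hC : IsCliqueComponent G X C)
    (hD : IsCliqueComponent G X D) (hne : C ≠ D) (hCD : Identical G X C D) {w w' u : V}
    (hw : w ∈ C) (hw' : w' ∈ D) (hcl : Clones G X w w') (huC : u ∉ C) (huD : u ∉ D) :
    G.dist w u = G.dist w' u := by
  classical
  obtain ⟨f, hf⟩ := hCD
  let f' : C ≃ D := f.trans (Equiv.swap (f ⟨w, hw⟩) ⟨w', hw'⟩)
  have hf' : ∀ u : C, G.neighborSet (f' u) ∩ X = G.neighborSet u ∩ X := by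
    intro u
    simp only [f', Equiv.trans_apply]
    rw [Equiv.swap_apply_def]
    split_ifs with h1 h2
    · rw [← f.injective h1.symm]; exact hcl.symm
    · rw [hf, ← hf u, h2]; exact hcl
    · exact hf u
  obtain ⟨σ, h1, -, h3⟩ := exists_iso_of_equiv hC hD hne f' hf'
  have hσ : σ w = w' := by rw [h1 ⟨w, hw⟩]; simp [f']
  have := hG.dist_iso σ w u
  rw [hσ, h3 u huC huD] at this
  exact this.symm

/-- A resolving set meets one of any two different identical cliques. -/
lemma IsResolving.inter_nonempty_or {C D S : Set V} (hG : G.Connected) (hS : IsResolving G S)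
    (hC : IsCliqueComponent G X C) (hD : IsCliqueComponent G X D) (hne : C ≠ D)
    (hCD : Identical G X C D) : (S ∩ C).Nonempty ∨ (S ∩ D).Nonempty := by
  obtain ⟨u, hu⟩ := hC.1
  obtain ⟨f, hf⟩ := id hCD
  have hfu := (f ⟨u, hu⟩).2
  obtain ⟨w, hwS, hw⟩ := hS u (f ⟨u, hu⟩) fun e => hne (hC.eq_of_mem hD hu (e ▸ hfu))
  by_cases hwC : w ∈ C
  · exact .inl ⟨w, hwS, hwC⟩
  by_cases hwD : w ∈ D
  · exact .inr ⟨w, hwS, hwD⟩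
  refine (hw ?_).elim
  rw [G.dist_comm, G.dist_comm (u := w)]
  exact dist_eq_of_clones hG hC hD hne hCD hu hfu (hf ⟨u, hu⟩).symm hwC hwD

/-- Deleting a clique that has an identical copy preserves distances. -/
lemma dist_induce_compl {C D : Set V} (hG : G.Connected) (hC : IsCliqueComponent G X C)
    (hD : IsCliqueComponent G X D) (hne : C ≠ D) (hCD : Identical G X C D)
    (a b : ↥(Cᶜ : Set V)) : (G.induce (Cᶜ : Set V)).dist a b = G.dist a b := by
  classical
  obtain ⟨f, hf⟩ := hCD
  obtain ⟨σ, h1, -, h3⟩ := exists_iso_of_equiv hC hD hne f hf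
  have hmem : ∀ v, (if v ∈ C then σ v else v) ∈ Cᶜ := by
    intro v
    split_ifs with h
    · rw [h1 ⟨v, h⟩]
      exact fun h' => hne (hC.eq_of_mem hD h' (f _).2)
    · exact h
  have hfix : ∀ x ∈ X, σ x = x := fun x hx =>
    h3 x (fun h => hC.2.1 h hx) (fun h => hD.2.1 h hx)
  let φ : G →g G.induce (Cᶜ : Set V) :=
    { toFun := fun v => ⟨if v ∈ C then σ v else v, hmem v⟩
      map_rel' := by
        intro x y hxy
        have hσ : G.Adj (σ x) (σ y) := σ.map_adj_iff.2 hxy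
        simp only [comap_adj, Function.Embedding.subtype_apply]
        split_ifs with hx hy hy
        · exact hσ
        · have hyX : y ∈ X := by_contra fun h => hy (hC.2.2.2 x hx y h hxy)
          rwa [hfix y hyX] at hσ
        · have hxX : x ∈ X := by_contra fun h => hx (hC.2.2.2 y hy x h hxy.symm)
          rwa [hfix x hxX] at hσ
        · exact hxy }
  have hφ : ∀ v : ↥(Cᶜ : Set V), φ v = v := fun v => Subtype.ext (if_neg v.2)
  have hconn : (G.induce (Cᶜ : Set V)).Connected :=
    { preconnected := fun x y => by
        have := (hG.preconnected x y).map φ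
        rwa [hφ, hφ] at this
      nonempty := ⟨a⟩ }
  apply le_antisymm
  · have := hG.dist_map_le φ a b
    rwa [hφ, hφ] at this
  · exact hconn.dist_map_le (Embedding.induce (Cᶜ : Set V)).toHom a b

lemma TrueTwins.symm {u v : V} (h : TrueTwins G u v) : TrueTwins G v u :=
  ⟨h.1.symm, h.2.symm⟩

lemma TrueTwins.trans {u v w : V} (h : TrueTwins G u v) (h' : TrueTwins G v w) (hne : u ≠ w) :
    TrueTwins G u w :=
  ⟨hne, h.2.trans h'.2⟩

lemma IsResolving.twinPairCount_le [Finite V] {C S : Set V} (hG : G.Connected)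
    (hT : NoThreeTrueTwins G) (hS : IsResolving G S) :
    twinPairCount G C ≤ (S ∩ C).ncard := by
  have := hG.nonempty
  have hex : ∀ p ∈ {p : Set V | ∃ u ∈ C, ∃ v ∈ C, TrueTwins G u v ∧ p = {u, v}},
      ∃ s ∈ S ∩ C, ∃ v, TrueTwins G s v ∧ p = {s, v} := by
    rintro p ⟨u, hu, v, hv, huv, rfl⟩
    obtain ⟨w, hwS, hw⟩ := hS u v huv.1
    by_cases h1 : w = u
    · subst h1; exact ⟨w, ⟨hwS, hu⟩, v, huv, rfl⟩
    by_cases h2 : w = v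
    · subst h2; exact ⟨w, ⟨hwS, hv⟩, u, huv.symm, Set.pair_comm _ _⟩
    exact (hw (huv.dist_eq hG h1 h2)).elim
  choose! s hs v hv hp using hex
  refine Set.ncard_le_ncard_of_injOn s hs ?_ (Set.toFinite _)
  intro p hp1 q hq e
  rw [hp p hp1, hp q hq, ← e]
  by_contra hne
  have hvv : v p ≠ v q := fun h => hne (by rw [h])
  have h1 := hv p hp1
  have h2 := hv q hq
  rw [← e] at h2
  exact hT ⟨_, _, _, h1, h2, h1.symm.trans h2 hvv⟩

/-- In a large family of identical cliques, some clique meets the resolving set `S` only in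
vertices whose type occurs in `S` in at least four cliques of the family. -/
lemma exists_redundant_clique [Finite V] {𝒞 : Set (Set V)} {S : Set V} (hG : G.Connected)
    (hS : IsResolving G S) (hcomp : ∀ C ∈ 𝒞, IsCliqueComponent G X C)
    (hid : ∀ C ∈ 𝒞, ∀ D ∈ 𝒞, Identical G X C D)
    (hcard : 3 * 2 ^ X.ncard + 1 < 𝒞.ncard) :
    ∃ D ∈ 𝒞, (S ∩ D).Nonempty ∧ ∀ w ∈ S ∩ D,
      4 ≤ {E ∈ 𝒞 | ∃ w' ∈ S ∩ E, Clones G X w w'}.ncard := by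
  classical
  have := hG.nonempty
  by_contra! hcon
  choose! w hw hlt using hcon
  have hmiss : {D ∈ 𝒞 | ¬ (S ∩ D).Nonempty}.ncard ≤ 1 := by
    rw [Set.ncard_le_one (Set.toFinite _)]
    rintro D ⟨hD, hD'⟩ E ⟨hE, hE'⟩
    by_contra hne
    exact (hS.inter_nonempty_or hG (hcomp D hD) (hcomp E hE) hne (hid D hD E hE)).elim hD' hE'
  have hhit : {D ∈ 𝒞 | (S ∩ D).Nonempty}.ncard ≤ 3 * 2 ^ X.ncard := by
    rw [← Set.ncard_powerset X (Set.toFinite _), Set.ncard_eq_toFinset_card _ (Set.toFinite _),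
      Set.ncard_eq_toFinset_card (𝒫 X) (Set.toFinite _)]
    refine Finset.card_le_mul_card_image_of_maps_to (f := fun D => G.neighborSet (w D) ∩ X)
      (by simp) 3 ?_
    intro T _
    rcases Finset.eq_empty_or_nonempty
      {D ∈ (Set.toFinite {D ∈ 𝒞 | (S ∩ D).Nonempty}).toFinset | G.neighborSet (w D) ∩ X = T}
      with he | ⟨D, hD⟩
    · simp [he]
    simp only [Finset.mem_filter, Set.Finite.mem_toFinset, Set.mem_ofPred_eq] at hD
    obtain ⟨⟨hD, hDS⟩, rfl⟩ := hD
    refine le_trans ?_ (Nat.le_of_lt_succ (hlt D hD hDS))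
    rw [← Set.ncard_coe_finset]
    refine Set.ncard_le_ncard ?_ (Set.toFinite _)
    intro E hE
    simp only [Finset.coe_filter, Set.Finite.mem_toFinset, Set.mem_ofPred_eq] at hE
    exact ⟨hE.1.1, w E, hw E hE.1.1 hE.1.2, hE.2.symm⟩
  have hunion : 𝒞 = {D ∈ 𝒞 | (S ∩ D).Nonempty} ∪ {D ∈ 𝒞 | ¬ (S ∩ D).Nonempty} := by
    ext D; simp only [Set.mem_union, Set.mem_ofPred_eq]; tauto
  have := Set.ncard_union_le {D ∈ 𝒞 | (S ∩ D).Nonempty} {D ∈ 𝒞 | ¬ (S ∩ D).Nonempty}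
  rw [← hunion] at this
  omega

/-- A clique as in `exists_redundant_clique` is not needed to resolve the vertices outside it. -/
lemma IsResolving.exists_mem_diff [Finite V] {𝒞 : Set (Set V)} {S D : Set V} (hG : G.Connected)
    (hS : IsResolving G S) (hcomp : ∀ C ∈ 𝒞, IsCliqueComponent G X C)
    (hid : ∀ C ∈ 𝒞, ∀ D ∈ 𝒞, Identical G X C D) (hD : D ∈ 𝒞)
    (hred : ∀ w ∈ S ∩ D, 4 ≤ {E ∈ 𝒞 | ∃ w' ∈ S ∩ E, Clones G X w w'}.ncard)
    {u v : V} (hu : u ∉ D) (hv : v ∉ D) (huv : u ≠ v) :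
    ∃ w ∈ S \ D, G.dist w u ≠ G.dist w v := by
  obtain ⟨w, hwS, hw⟩ := hS u v huv
  by_cases hwD : w ∈ D
  swap
  · exact ⟨w, ⟨hwS, hwD⟩, hw⟩
  have hsmall : ∀ z, {E ∈ 𝒞 | z ∈ E}.ncard ≤ 1 := by
    intro z
    rw [Set.ncard_le_one (Set.toFinite _)]
    rintro E ⟨hE, hzE⟩ F ⟨hF, hzF⟩
    exact (hcomp E hE).eq_of_mem (hcomp F hF) hzE hzF
  have h3 : ({D} ∪ {E ∈ 𝒞 | u ∈ E} ∪ {E ∈ 𝒞 | v ∈ E}).ncard ≤ 3 := by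
    have h1 := Set.ncard_union_le ({D} ∪ {E ∈ 𝒞 | u ∈ E}) {E ∈ 𝒞 | v ∈ E}
    have h2 := Set.ncard_union_le {D} {E ∈ 𝒞 | u ∈ E}
    have := Set.ncard_singleton D
    have := hsmall u
    have := hsmall v
    omega
  obtain ⟨E, ⟨hE, w', ⟨hwS', hwE'⟩, hcl⟩, hEn⟩ := Set.exists_mem_notMem_of_ncard_lt_ncard
    (h3.trans_lt (Nat.lt_of_succ_le (hred w ⟨hwS, hwD⟩))) (Set.toFinite _)
  simp only [Set.mem_union, Set.mem_singleton_iff, Set.mem_ofPred_eq, not_or, not_and] at hEn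
  obtain ⟨⟨hED, hEu⟩, hEv⟩ := hEn
  have key : ∀ z, z ∉ D → z ∉ E → G.dist w z = G.dist w' z := fun z hzD hzE =>
    dist_eq_of_clones hG (hcomp D hD) (hcomp E hE) (Ne.symm hED) (hid D hD E hE) hwD hwE' hcl
      hzD hzE
  refine ⟨w', ⟨hwS', fun h => hED ((hcomp E hE).eq_of_mem (hcomp D hD) hwE' h)⟩, ?_⟩
  rwa [← key u hu (hEu hE), ← key v hv (hEv hE)]

end CliqueDeletion

/-- forward direction of the clique-deletion reduction rule. -/
theorem delete_clique_forward [Fintype V] (G : SimpleGraph V) (hG : G.Connected)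
    (hT : NoThreeTrueTwins G) (X : Set V) (hX : IsClusterModulator G X)
    (𝒞 : Set (Set V)) (h𝒞 : IsIdenticalClass G X 𝒞)
    (t : ℕ) (ht : ∀ C' ∈ 𝒞, twinPairCount G C' = t)
    (hcard : 2 ^ (X.ncard + 2) + X.ncard + 2 ≤ 𝒞.ncard)
    (C : Set V) (hC : C ∈ 𝒞) (k : ℕ) (hk : max 1 t ≤ k)
    (h : ∃ S : Set V, IsResolving G S ∧ S.ncard ≤ k) :
    ∃ S : Set ↥(Cᶜ : Set V), IsResolving (G.induce (Cᶜ : Set V)) S ∧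
      S.ncard ≤ k - max 1 t := by
  classical
  obtain ⟨S, hS, hSk⟩ := h
  obtain ⟨hcomp, hid, -⟩ := h𝒞
  have hpow : 2 ^ (X.ncard + 2) = 4 * 2 ^ X.ncard := by ring
  obtain ⟨D, hD, hDS, hred⟩ := exists_redundant_clique hG hS hcomp hid (by omega)
  have hDt : max 1 t ≤ (S ∩ D).ncard :=
    max_le ((Set.ncard_pos (Set.toFinite _)).2 hDS) (ht D hD ▸ hS.twinPairCount_le hG hT)
  have hdiff := Set.ncard_inter_add_ncard_sdiff_eq_ncard S D (Set.toFinite _)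
  obtain ⟨E, hE, hEC⟩ : ∃ E ∈ 𝒞, E ≠ C := by
    apply Set.exists_ne_of_one_lt_ncard
    omega
  obtain ⟨σ, hσ⟩ : ∃ σ : G ≃g G, ∀ v, σ v ∈ D ↔ v ∈ C := by
    by_cases hCD : C = D
    · exact ⟨Iso.refl, fun v => by simp [hCD]⟩
    obtain ⟨f, hf⟩ := hid C hC D hD
    obtain ⟨σ, h1, h2, h3⟩ := exists_iso_of_equiv (hcomp C hC) (hcomp D hD) hCD f hf
    have hdis : ∀ v ∈ C, v ∉ D := fun v h h' => hCD ((hcomp C hC).eq_of_mem (hcomp D hD) h h')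
    refine ⟨σ, fun v => ⟨fun h => ?_, fun h => ?_⟩⟩
    · by_contra hvC
      by_cases hvD : v ∈ D
      · rw [h2 ⟨v, hvD⟩] at h
        exact hdis _ (f.symm _).2 h
      · rw [h3 v hvC hvD] at h
        exact hvD h
    · rw [h1 ⟨v, h⟩]
      exact (f _).2
  refine ⟨{v | σ v ∈ S \ D}, ?_, ?_⟩
  · intro u v huv
    obtain ⟨w, hw, hwuv⟩ := hS.exists_mem_diff hG hcomp hid hD hred
      (fun h => u.2 ((hσ u).1 h)) (fun h => v.2 ((hσ v).1 h))
      (fun h => huv (Subtype.ext (σ.injective h)))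
    have hwC : σ.symm w ∈ (Cᶜ : Set V) := fun h => hw.2 (by simpa using (hσ _).2 h)
    refine ⟨⟨σ.symm w, hwC⟩, by simpa using hw, ?_⟩
    have hdist := dist_induce_compl hG (hcomp C hC) (hcomp E hE) hEC.symm (hid C hC E hE)
    rw [hdist, hdist, ← hG.dist_iso σ, ← hG.dist_iso σ _ (v : V)]
    simpa using hwuv
  · have : {v : ↥(Cᶜ : Set V) | σ v ∈ S \ D}.ncard ≤ (S \ D).ncard :=
      Set.ncard_le_ncard_of_injOn (fun v => σ v) (fun v hv => hv)
        (fun u _ v _ h => Subtype.ext (σ.injective h)) (Set.toFinite _)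
    omega
end

section
/- Let G be a graph in which no three distinct vertices are pairwise true twins, and let X be a cluster modulator of G such that every equivalence class of identical cliques of G − X contains at most 2^{|X|+2} + |X| + 1 cliques. Then G has at most 2^{2^{|X|+1}} · (2^{|X|+2} + |X| + 1) · 2^{|X|+1} + |X| vertices. -/
open SimpleGraph

variable {V : Type*}

/-- The neighborhood in `X` of a vertex, as a subset of `X`. -/
def modulatorNbhd (G : SimpleGraph V) (X : Set V) (u : V) : 𝒫 X :=
  ⟨G.neighborSet u ∩ X, Set.inter_subset_right⟩

/-- The clique of `G - X` containing `v`, for `v ∉ X`. -/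
def cliqueAt (G : SimpleGraph V) (X : Set V) (v : V) : Set V :=
  {b | b ∉ X ∧ (b = v ∨ G.Adj v b)}

/-- The signature of `C` with multiplicities truncated at two. -/
noncomputable def truncatedSignature (G : SimpleGraph V) (X C : Set V) (t : 𝒫 X) : Fin 3 :=
  ⟨min {u ∈ C | modulatorNbhd G X u = t}.ncard 2, by omega⟩

theorem isCliqueComponent_cliqueAt {G : SimpleGraph V} {X : Set V}
    (hX : IsClusterModulator G X) {v : V} (hv : v ∉ X) :
    IsCliqueComponent G X (cliqueAt G X v) := by
  have trans : ∀ a b c : V, a ∉ X → b ∉ X → c ∉ X → G.Adj a b → G.Adj b c → a = c ∨ G.Adj a c := by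
    intro a b c ha hb hc hab hbc
    have h1 : (G.induce Xᶜ).Adj ⟨a, ha⟩ ⟨b, hb⟩ := hab
    have h2 : (G.induce Xᶜ).Adj ⟨b, hb⟩ ⟨c, hc⟩ := hbc
    rcases hX _ _ (h1.reachable.trans h2.reachable) with h | h
    · exact Or.inl (congrArg Subtype.val h)
    · exact Or.inr h
  refine ⟨⟨v, hv, Or.inl rfl⟩, fun b hb => hb.1, ?_, ?_⟩
  · rintro a ⟨ha, rfl | hva⟩ b ⟨hb, rfl | hvb⟩ hab
    · exact absurd rfl hab
    · exact hvb
    · exact hva.symm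
    · exact (trans a v b ha hv hb hva.symm hvb).resolve_left hab
  · rintro a ⟨ha, rfl | hva⟩ b hb hab
    · exact ⟨hb, Or.inr hab⟩
    · refine ⟨hb, ?_⟩
      rcases trans v a b hv ha hb hva hab with h | h
      · exact Or.inl h.symm
      · exact Or.inr h

theorem IsCliqueComponent.trueTwins {G : SimpleGraph V} {X C : Set V}
    (hC : IsCliqueComponent G X C) {u v : V} (hu : u ∈ C) (hv : v ∈ C) (huv : u ≠ v)
    (h : modulatorNbhd G X u = modulatorNbhd G X v) : TrueTwins G u v := by
  have sub : ∀ a ∈ C, ∀ b ∈ C, modulatorNbhd G X a = modulatorNbhd G X b →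
      insert a (G.neighborSet a) ⊆ insert b (G.neighborSet b) := by
    intro a ha b hb hab x hx
    have hN : G.neighborSet a ∩ X = G.neighborSet b ∩ X := congrArg Subtype.val hab
    by_cases hxX : x ∈ X
    · rcases hx with rfl | hx
      · exact absurd hxX (hC.2.1 ha)
      · exact Or.inr (hN.subset ⟨hx, hxX⟩).1
    · have hxC : x ∈ C := by
        rcases hx with rfl | hx
        · exact ha
        · exact hC.2.2.2 a ha x hxX hx
      by_cases hbx : x = b
      · exact Or.inl hbx
      · exact Or.inr (hC.2.2.1 b hb x hxC (Ne.symm hbx))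
  exact ⟨huv, (sub u hu v hv h).antisymm (sub v hv u hu h.symm)⟩

theorem IsCliqueComponent.ncard_clones_le_two [Finite V] {G : SimpleGraph V}
    (hT : NoThreeTrueTwins G) {X C : Set V} (hC : IsCliqueComponent G X C) (t : 𝒫 X) :
    {u ∈ C | modulatorNbhd G X u = t}.ncard ≤ 2 := by
  by_contra! hlt
  obtain ⟨a, b, c, ha, hb, hc, hab, hac, hbc⟩ := (Set.two_lt_ncard_iff (Set.toFinite _)).1 hlt
  exact hT ⟨a, b, c, hC.trueTwins ha.1 hb.1 hab (ha.2.trans hb.2.symm),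
    hC.trueTwins ha.1 hc.1 hac (ha.2.trans hc.2.symm),
    hC.trueTwins hb.1 hc.1 hbc (hb.2.trans hc.2.symm)⟩

theorem identical_of_truncatedSignature_eq [Finite V] {G : SimpleGraph V}
    (hT : NoThreeTrueTwins G) {X C D : Set V} (hC : IsCliqueComponent G X C)
    (hD : IsCliqueComponent G X D)
    (h : truncatedSignature G X C = truncatedSignature G X D) : Identical G X C D := by
  have key : ∀ t : 𝒫 X, Nonempty ({a : C // modulatorNbhd G X a = t} ≃
      {b : D // modulatorNbhd G X b = t}) := by
    intro t
    have hcard : {u ∈ C | modulatorNbhd G X u = t}.ncard =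
        {u ∈ D | modulatorNbhd G X u = t}.ncard := by
      have h1 := congrArg Fin.val (congrFun h t)
      simp only [truncatedSignature] at h1
      rwa [min_eq_left (hC.ncard_clones_le_two hT t),
        min_eq_left (hD.ncard_clones_le_two hT t)] at h1
    have e := (Finite.card_eq.1 hcard).some
    exact ⟨(Equiv.subtypeSubtypeEquivSubtypeInter (· ∈ C) (modulatorNbhd G X · = t)).trans
      (e.trans (Equiv.subtypeSubtypeEquivSubtypeInter (· ∈ D) (modulatorNbhd G X · = t)).symm)⟩
  have e := fun t => (key t).some
  refine ⟨Equiv.ofFiberEquiv (f := fun a : C => modulatorNbhd G X a)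
    (g := fun b : D => modulatorNbhd G X b) e, fun u => ?_⟩
  exact congrArg Subtype.val (Equiv.ofFiberEquiv_map (f := fun a : C => modulatorNbhd G X a)
    (g := fun b : D => modulatorNbhd G X b) e u)

theorem Identical.symm {G : SimpleGraph V} {X C D : Set V} (h : Identical G X C D) :
    Identical G X D C := by
  obtain ⟨f, hf⟩ := h
  exact ⟨f.symm, fun u => by simpa using (hf (f.symm u)).symm⟩

theorem Identical.trans {G : SimpleGraph V} {X C D E : Set V} (h : Identical G X C D)
    (h' : Identical G X D E) : Identical G X C E := by
  obtain ⟨f, hf⟩ := h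
  obtain ⟨g, hg⟩ := h'
  exact ⟨f.trans g, fun u => (hg (f u)).trans (hf u)⟩

theorem isIdenticalClass_setOf_identical (G : SimpleGraph V) (X C : Set V) :
    IsIdenticalClass G X {D | IsCliqueComponent G X D ∧ Identical G X D C} :=
  ⟨fun _ h => h.1, fun _ h _ h' => h.2.trans h'.2.symm,
    fun _ hD ⟨_, h', hi⟩ => ⟨hD, hi.trans h'.2⟩⟩

theorem natCard_powerset [Finite V] (X : Set V) : Nat.card (𝒫 X) = 2 ^ X.ncard :=
  Set.ncard_powerset X (Set.toFinite X)

theorem IsCliqueComponent.ncard_le [Finite V] {G : SimpleGraph V} (hT : NoThreeTrueTwins G)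
    {X C : Set V} (hC : IsCliqueComponent G X C) : C.ncard ≤ 2 ^ (X.ncard + 1) := by
  classical
  have := Fintype.ofFinite V
  have := Fintype.ofFinite (𝒫 X)
  have h := Finset.card_le_mul_card_image (f := modulatorNbhd G X) C.toFinset 2 (by
    intro t _
    have := hC.ncard_clones_le_two hT t
    rw [Set.ncard_eq_toFinset_card'] at this
    convert this using 2
    ext; simp)
  have h2 := Finset.card_le_univ (C.toFinset.image (modulatorNbhd G X))
  rw [← Nat.card_eq_fintype_card, natCard_powerset] at h2
  rw [Set.ncard_eq_toFinset_card', pow_succ']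
  exact h.trans (Nat.mul_le_mul_left _ h2)

theorem ncard_cliqueComponents_le [Finite V] {G : SimpleGraph V} (hT : NoThreeTrueTwins G)
    {X : Set V} {n : ℕ} (hclass : ∀ 𝒞 : Set (Set V), IsIdenticalClass G X 𝒞 → 𝒞.ncard ≤ n) :
    {C | IsCliqueComponent G X C}.ncard ≤ 2 ^ (2 ^ (X.ncard + 1)) * n := by
  classical
  have := Fintype.ofFinite V
  have := Fintype.ofFinite (𝒫 X)
  set 𝒦 : Set (Set V) := {C | IsCliqueComponent G X C}
  have h := Finset.card_le_mul_card_image (f := truncatedSignature G X) 𝒦.toFinset n (by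
    intro σ hσ
    obtain ⟨C, hC, rfl⟩ := Finset.mem_image.1 hσ
    have hC : C ∈ 𝒦 := Set.mem_toFinset.1 hC
    refine le_trans ?_ (hclass _ (isIdenticalClass_setOf_identical G X C))
    rw [← Set.ncard_coe_finset]
    refine Set.ncard_le_ncard (fun D hD => ?_) (Set.toFinite _)
    obtain ⟨hD, hs⟩ := Finset.mem_filter.1 (Finset.mem_coe.1 hD)
    have hD : D ∈ 𝒦 := Set.mem_toFinset.1 hD
    exact ⟨hD, identical_of_truncatedSignature_eq hT hD hC hs⟩)
  have h2 := Finset.card_le_univ (𝒦.toFinset.image (truncatedSignature G X))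
  rw [Fintype.card_fun, Fintype.card_fin, ← Nat.card_eq_fintype_card, natCard_powerset] at h2
  have h3 : 3 ^ 2 ^ X.ncard ≤ 2 ^ (2 ^ (X.ncard + 1)) := by
    rw [pow_succ' 2 X.ncard, pow_mul]
    exact Nat.pow_le_pow_left (by norm_num) _
  rw [Set.ncard_eq_toFinset_card', mul_comm]
  exact h.trans (Nat.mul_le_mul_left _ (h2.trans h3))

/-- bound on the number of vertices of the reduced graph. -/
theorem kernel_size_bound [Fintype V] (G : SimpleGraph V) (hT : NoThreeTrueTwins G)
    (X : Set V) (hX : IsClusterModulator G X)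
    (hclass : ∀ 𝒞 : Set (Set V), IsIdenticalClass G X 𝒞 →
      𝒞.ncard ≤ 2 ^ (X.ncard + 2) + X.ncard + 1) :
    Fintype.card V ≤
      2 ^ (2 ^ (X.ncard + 1)) * (2 ^ (X.ncard + 2) + X.ncard + 1) * 2 ^ (X.ncard + 1)
        + X.ncard := by
  classical
  have h := Finset.card_le_mul_card_image (f := cliqueAt G X) Xᶜ.toFinset (2 ^ (X.ncard + 1)) (by
    intro C hC
    obtain ⟨v, hv, rfl⟩ := Finset.mem_image.1 hC
    have hv : v ∉ X := Set.mem_toFinset.1 hv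
    refine le_trans ?_ ((isCliqueComponent_cliqueAt hX hv).ncard_le hT)
    rw [← Set.ncard_coe_finset]
    refine Set.ncard_le_ncard (fun u hu => ?_) (Set.toFinite _)
    obtain ⟨hu, hs⟩ := Finset.mem_filter.1 (Finset.mem_coe.1 hu)
    rw [← hs]
    exact ⟨Set.mem_toFinset.1 hu, Or.inl rfl⟩)
  have himage : (Xᶜ.toFinset.image (cliqueAt G X)).card ≤
      {C | IsCliqueComponent G X C}.ncard := by
    rw [← Set.ncard_coe_finset]
    refine Set.ncard_le_ncard (fun C hC => ?_) (Set.toFinite _)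
    obtain ⟨v, hv, rfl⟩ := Finset.mem_image.1 (Finset.mem_coe.1 hC)
    exact isCliqueComponent_cliqueAt hX (Set.mem_toFinset.1 hv)
  have hcompl : Xᶜ.ncard ≤ 2 ^ (2 ^ (X.ncard + 1)) * (2 ^ (X.ncard + 2) + X.ncard + 1) *
      2 ^ (X.ncard + 1) := by
    rw [Set.ncard_eq_toFinset_card' Xᶜ, mul_comm]
    exact h.trans (Nat.mul_le_mul_left _ (himage.trans (ncard_cliqueComponents_le hT hclass)))
  have hadd := Set.ncard_add_ncard_compl X
  rw [Nat.card_eq_fintype_card] at hadd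
  omega
end
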